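/- arXiv:cs/0609085 — 3 statements merged into one kernel-verified Lean document; each statement's English description precedes it below -/
import Mathlib

section
/- For every rooted tree T with n+1 vertices and every integer τ with 1 ≤ τ ≤ n, there exists a set C of vertices of T containing the root such that |C| ≤ n/τ + 1 and every vertex of T has an ancestor in C (possibly the vertex itself) at distance at most 2τ from it. -/
/-- For every rooted tree `T` with `n+1` vertices (given by a finite vertex set, a
root, and a parent function under which every vertex reaches the root) and every
integer `τ` with `1 ≤ τ ≤ n`, there is a set `C` of vertices containing the root such
that `|C| ≤ n/τ + 1` and every vertex has an ancestor in `C` (possibly itself) at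
distance at most `2τ` from it. -/
theorem exists_covering_set_of_rooted_tree {V : Type*} [Fintype V] [DecidableEq V]
    (n τ : ℕ) (hcard : Fintype.card V = n + 1) (hτ1 : 1 ≤ τ) (hτn : τ ≤ n)
    (root : V) (parent : V → V)
    (hroot : parent root = root)
    (hconn : ∀ v : V, ∃ t : ℕ, parent^[t] v = root) :
    ∃ C : Finset V, root ∈ C ∧ (C.card : ℝ) ≤ (n : ℝ) / (τ : ℝ) + 1 ∧
      ∀ v : V, ∃ t : ℕ, t ≤ 2 * τ ∧ parent^[t] v ∈ C := by
  classical
  set depth : V → ℕ := fun v => Nat.find (hconn v) with hdepth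
  have hreach (v : V) : parent^[depth v] v = root := Nat.find_spec (hconn v)
  have hstep (v : V) (t : ℕ) (ht : t ≤ depth v) : depth (parent^[t] v) = depth v - t := by
    refine (Nat.find_eq_iff (hconn _)).2 ⟨?_, fun k hk hroot' => ?_⟩
    · rw [← Function.iterate_add_apply, Nat.sub_add_cancel ht, hreach]
    · rw [← Function.iterate_add_apply] at hroot'
      exact Nat.find_min (hconn v) (Nat.lt_sub_iff_add_lt.1 hk) hroot'
  have hτ : (0 : ℝ) < τ := by exact_mod_cast hτ1
  obtain ⟨r, hr, hfiber⟩ := Finset.exists_card_fiber_le_of_card_le_nsmul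
    (s := Finset.univ.erase root) (t := Finset.range τ) (f := fun v => depth v % τ)
    (b := (n : ℝ) / τ) (Finset.nonempty_range_iff.2 (by omega))
    (by simp [Finset.card_erase_of_mem, hcard, mul_div_cancel₀ _ hτ.ne'])
  rw [Finset.mem_range] at hr
  refine ⟨insert root ((Finset.univ.erase root).filter fun v => depth v % τ = r),
    Finset.mem_insert_self _ _, ?_, fun v => ?_⟩
  · calc _ ≤ (((Finset.univ.erase root).filter fun v => depth v % τ = r).card : ℝ) + 1 := by
          exact_mod_cast Finset.card_insert_le _ _
      _ ≤ _ := by gcongr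
  · by_cases hv : depth v < τ
    · exact ⟨depth v, by omega, by simp [hreach]⟩
    · obtain ⟨t, htτ, ht⟩ : ∃ t ≤ τ, (depth v - t) % τ = r := by
        have hq := Nat.mod_add_div (depth v) τ
        have hlt := Nat.mod_lt (depth v) hτ1
        by_cases hqr : r ≤ depth v % τ
        · refine ⟨depth v % τ - r, by omega, ?_⟩
          rw [show depth v - (depth v % τ - r) = r + τ * (depth v / τ) by omega,
            Nat.add_mul_mod_self_left, Nat.mod_eq_of_lt hr]
        · obtain ⟨k, hk⟩ := Nat.exists_eq_succ_of_ne_zero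
            (Nat.div_pos (not_lt.1 hv) hτ1).ne'
          refine ⟨depth v % τ + τ - r, by omega, ?_⟩
          rw [hk, Nat.mul_succ] at hq
          rw [show depth v - (depth v % τ + τ - r) = r + τ * k by omega,
            Nat.add_mul_mod_self_left, Nat.mod_eq_of_lt hr]
      refine ⟨t, by omega, ?_⟩
      rw [Finset.mem_insert, Finset.mem_filter, Finset.mem_erase, hstep v t (by omega)]
      by_cases h : parent^[t] v = root <;> simp [h, ht]
end

section
/- Let M be an ε-NFA with a designated start state θ and accepting set Φ, and let B = b_1 ⋯ b_u be a string. Define state sets T_0, T_1, …, T_u by T_0 = εClosure({θ}) and T_j = stepSet(T_{j−1} ∪ εClosure({θ}), b_j) for 1 ≤ j ≤ u. Then for every 1 ≤ j ≤ u, T_j = ⋃_{i=1}^{j} evalFrom({θ}, B[i..j]). Consequently, T_j ∩ Φ ≠ ∅ if and only if j is a match of M in B, i.e., there exists i ∈ [1, j] such that M accepts B[i..j]. -/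
/-- The sets of states `T_0, T_1, …` computed by the matching algorithm on a text
`B`: `T_0 = εClosure({θ})` and `T_j = stepSet(T_{j−1} ∪ εClosure({θ}), b_j)` where
`b_j` is the `j`-th character of `B`. -/
def matchStates {α σ : Type*} (M : εNFA α σ) (θ : σ) (B : List α) (j : ℕ) : Set σ :=
  (B.take j).foldl (fun S b => M.stepSet (S ∪ M.εClosure {θ}) b) (M.εClosure {θ})

/-- Folding the matching step over a word, then adding `εClosure({θ})`, collects the states
reached from `θ` by the suffixes of the word. -/
theorem mem_foldl_union_εClosure_iff {α σ : Type*} (M : εNFA α σ) (θ : σ) (w : List α) (s : σ) :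
    s ∈ w.foldl (fun S b => M.stepSet (S ∪ M.εClosure {θ}) b) (M.εClosure {θ}) ∪ M.εClosure {θ} ↔
      ∃ k ≤ w.length, s ∈ M.evalFrom {θ} (w.drop k) := by
  induction w using List.reverseRecOn generalizing s with
  | nil => simp
  | append_singleton w a ih =>
    rw [List.foldl_append, List.foldl_cons, List.foldl_nil, Set.mem_union, εNFA.mem_stepSet_iff]
    constructor
    · rintro (⟨t, ht, hs⟩ | hs)
      · obtain ⟨k, hk, ht⟩ := (ih t).1 ht
        refine ⟨k, by simp; omega, ?_⟩
        rw [List.drop_append_of_le_length hk, εNFA.evalFrom_append_singleton,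
          εNFA.mem_stepSet_iff]
        exact ⟨t, ht, hs⟩
      · exact ⟨(w ++ [a]).length, le_rfl, by simpa using hs⟩
    · rintro ⟨k, hk, hs⟩
      by_cases hkw : k ≤ w.length
      · rw [List.drop_append_of_le_length hkw, εNFA.evalFrom_append_singleton,
          εNFA.mem_stepSet_iff] at hs
        obtain ⟨t, ht, hs⟩ := hs
        exact Or.inl ⟨t, (ih t).2 ⟨k, hkw, ht⟩, hs⟩
      · rw [List.drop_of_length_le (by simp; omega)] at hs
        exact Or.inr hs

/-- After reading a nonempty word, the matching fold holds exactly the states reached from `θ`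
by the nonempty suffixes of that word. -/
theorem mem_foldl_append_singleton_iff {α σ : Type*} (M : εNFA α σ) (θ : σ) (w : List α) (a : α)
    (s : σ) :
    s ∈ (w ++ [a]).foldl (fun S b => M.stepSet (S ∪ M.εClosure {θ}) b) (M.εClosure {θ}) ↔
      ∃ k ≤ w.length, s ∈ M.evalFrom {θ} ((w ++ [a]).drop k) := by
  rw [List.foldl_append, List.foldl_cons, List.foldl_nil, εNFA.mem_stepSet_iff]
  simp only [mem_foldl_union_εClosure_iff]
  constructor
  · rintro ⟨t, ⟨k, hk, ht⟩, hs⟩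
    refine ⟨k, hk, ?_⟩
    rw [List.drop_append_of_le_length hk, εNFA.evalFrom_append_singleton, εNFA.mem_stepSet_iff]
    exact ⟨t, ht, hs⟩
  · rintro ⟨k, hk, hs⟩
    rw [List.drop_append_of_le_length hk, εNFA.evalFrom_append_singleton,
      εNFA.mem_stepSet_iff] at hs
    obtain ⟨t, ht, hs⟩ := hs
    exact ⟨t, ⟨k, hk, ht⟩, hs⟩

/-- Let `M` be an ε-NFA with designated start state `θ` (and accepting set
`M.accept`), and let `B = b_1 ⋯ b_u`. With `T_0 = εClosure({θ})` and
`T_j = stepSet(T_{j−1} ∪ εClosure({θ}), b_j)`, for every `1 ≤ j ≤ u` we have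
`T_j = ⋃_{i=1}^{j} evalFrom({θ}, B[i..j])`; consequently `T_j ∩ Φ ≠ ∅` iff `j` is a
match of `M` in `B`, i.e. there is `i ∈ [1, j]` such that `M` accepts `B[i..j]`. -/
theorem matchStates_eq_union_evalFrom {α σ : Type*} (M : εNFA α σ) (θ : σ)
    (hstart : M.start = {θ}) (B : List α) (j : ℕ) (h1 : 1 ≤ j) (h2 : j ≤ B.length) :
    (matchStates M θ B j =
      ⋃ i ∈ Finset.Icc 1 j, M.evalFrom {θ} ((B.drop (i - 1)).take (j - i + 1))) ∧
    ((matchStates M θ B j ∩ M.accept).Nonempty ↔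
      ∃ i : ℕ, 1 ≤ i ∧ i ≤ j ∧ (B.drop (i - 1)).take (j - i + 1) ∈ M.accepts) := by
  have key : matchStates M θ B j =
      ⋃ i ∈ Finset.Icc 1 j, M.evalFrom {θ} ((B.drop (i - 1)).take (j - i + 1)) := by
    obtain ⟨n, rfl⟩ : ∃ n, j = n + 1 := ⟨j - 1, by omega⟩
    have htake : B.take (n + 1) = B.take n ++ [B[n]] := List.take_succ_eq_append_getElem h2
    have hlen : (B.take n).length = n := by simp; omega
    ext s
    rw [matchStates, htake, mem_foldl_append_singleton_iff, ← htake, hlen]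
    simp only [Set.mem_iUnion, Finset.mem_Icc, exists_prop, List.drop_take]
    constructor
    · rintro ⟨k, hk, hs⟩
      refine ⟨k + 1, ⟨by omega, by omega⟩, ?_⟩
      rwa [Nat.add_sub_cancel, show n + 1 - (k + 1) + 1 = n + 1 - k by omega]
    · rintro ⟨i, ⟨hi, hin⟩, hs⟩
      refine ⟨i - 1, by omega, ?_⟩
      rwa [show n + 1 - (i - 1) = n + 1 - i + 1 by omega]
  refine ⟨key, ?_⟩
  rw [key]
  constructor
  · rintro ⟨s, hs, hacc⟩
    simp only [Set.mem_iUnion, Finset.mem_Icc, exists_prop] at hs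
    obtain ⟨i, ⟨hi, hij⟩, hs⟩ := hs
    refine ⟨i, hi, hij, s, hacc, ?_⟩
    rwa [εNFA.eval, hstart]
  · rintro ⟨i, hi, hij, s, hacc, hs⟩
    rw [εNFA.eval, hstart] at hs
    refine ⟨s, ?_, hacc⟩
    simp only [Set.mem_iUnion, Finset.mem_Icc, exists_prop]
    exact ⟨i, ⟨hi, hij⟩, hs⟩
end

section
/- Let M be an ε-NFA with start state θ and accepting set Φ, let X and Y be strings, and let d be an integer with 1 ≤ d ≤ |Y|. Then |X| + d is a match of M in X·Y if and only if d is a match of M in Y, or there exists i ∈ [1, |X|] and a state s ∈ evalFrom({θ}, X[i..|X|]) such that evalFrom({s}, Y[1..d]) ∩ Φ ≠ ∅. That is, matches of M ending inside the Y-part of X·Y are exactly the internal matches in Y together with the overlapping matches continuing computations from states reachable from θ by reading some suffix of X. -/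
/-- `j` is a match of the ε-NFA `M` in the text `B`: `j ∈ [1,|B|]` and there is
`i ∈ [1, j]` such that `M` accepts the substring `B[i..j]`. -/
def NFAIsMatch {α σ : Type*} (M : εNFA α σ) (B : List α) (j : ℕ) : Prop :=
  1 ≤ j ∧ j ≤ B.length ∧
    ∃ i : ℕ, 1 ≤ i ∧ i ≤ j ∧ (B.drop (i - 1)).take (j - i + 1) ∈ M.accepts

namespace εNFA

variable {α σ : Type*} (M : εNFA α σ)

theorem εClosure_εClosure (S : Set σ) : M.εClosure (M.εClosure S) = M.εClosure S := by
  refine Set.Subset.antisymm (fun s hs => ?_) (M.subset_εClosure _)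
  induction hs with
  | base s hs => exact hs
  | step s t ht _ ih => exact εClosure.step s t ht ih

theorem εClosure_stepSet (S : Set σ) (a : α) :
    M.εClosure (M.stepSet S a) = M.stepSet S a := by
  refine Set.Subset.antisymm (fun s hs => ?_) (M.subset_εClosure _)
  induction hs with
  | base s hs => exact hs
  | step s t ht _ ih =>
    obtain ⟨u, hu, hs⟩ := mem_stepSet_iff.1 ih
    exact mem_stepSet_iff.2 ⟨u, hu, εClosure.step s t ht hs⟩

theorem εClosure_evalFrom (S : Set σ) (x : List α) :
    M.εClosure (M.evalFrom S x) = M.evalFrom S x := by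
  induction x using List.reverseRecOn with
  | nil => exact M.εClosure_εClosure S
  | append_singleton x a _ => rw [evalFrom_append_singleton, εClosure_stepSet]

theorem evalFrom_append (S : Set σ) (x y : List α) :
    M.evalFrom S (x ++ y) = M.evalFrom (M.evalFrom S x) y := by
  have h : M.evalFrom (M.evalFrom S x) y = y.foldl M.stepSet (M.εClosure (M.evalFrom S x)) := rfl
  rw [h, εClosure_evalFrom]
  exact List.foldl_append

theorem append_mem_accepts_iff (x y : List α) :
    x ++ y ∈ M.accepts ↔
      ∃ s ∈ M.evalFrom M.start x, (M.evalFrom {s} y ∩ M.accept).Nonempty := by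
  change (∃ t ∈ M.accept, t ∈ M.evalFrom M.start (x ++ y)) ↔ _
  simp only [evalFrom_append, Set.Nonempty, Set.mem_inter_iff]
  constructor
  · rintro ⟨t, ht, h⟩
    obtain ⟨s, hs, hst⟩ := M.mem_evalFrom_iff_exists.1 h
    exact ⟨s, hs, t, hst, ht⟩
  · rintro ⟨s, hs, t, hst, ht⟩
    exact ⟨t, ht, M.mem_evalFrom_iff_exists.2 ⟨s, hs, hst⟩⟩

end εNFA

theorem List.take_drop_append_of_le {α : Type*} (X Y : List α) {i : ℕ} (d : ℕ)
    (h1 : 1 ≤ i) (h2 : i ≤ X.length) :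
    ((X ++ Y).drop (i - 1)).take (X.length + d - i + 1) = X.drop (i - 1) ++ Y.take d := by
  have h : X.length + d - i + 1 = (X.drop (i - 1)).length + d := by
    rw [List.length_drop]; omega
  rw [List.drop_append_of_le_length (by omega), h, List.take_length_add_append]

theorem List.take_drop_append_length_add {α : Type*} (X Y : List α) {i : ℕ} (d : ℕ)
    (h1 : 1 ≤ i) :
    ((X ++ Y).drop (X.length + i - 1)).take (X.length + d - (X.length + i) + 1) =
      (Y.drop (i - 1)).take (d - i + 1) := by
  rw [Nat.add_sub_assoc h1, List.drop_length_add_append, Nat.add_sub_add_left]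

/-- Let `M` be an ε-NFA with start state `θ` and accepting set `Φ = M.accept`, let
`X, Y` be strings and `1 ≤ d ≤ |Y|`. Then `|X| + d` is a match of `M` in `X·Y` iff
`d` is a match of `M` in `Y`, or there exist `i ∈ [1, |X|]` and a state
`s ∈ evalFrom({θ}, X[i..|X|])` with `evalFrom({s}, Y[1..d]) ∩ Φ ≠ ∅`. -/
theorem match_in_concat_iff {α σ : Type*} (M : εNFA α σ) (θ : σ)
    (hstart : M.start = {θ}) (X Y : List α) (d : ℕ)
    (h1 : 1 ≤ d) (h2 : d ≤ Y.length) :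
    NFAIsMatch M (X ++ Y) (X.length + d) ↔
      (NFAIsMatch M Y d ∨
        ∃ i : ℕ, 1 ≤ i ∧ i ≤ X.length ∧
          ∃ s ∈ M.evalFrom {θ} (X.drop (i - 1)),
            (M.evalFrom {s} (Y.take d) ∩ M.accept).Nonempty) := by
  constructor
  · rintro ⟨-, -, i, hi, hid, hacc⟩
    rcases le_or_gt i X.length with hX | hX
    · rw [List.take_drop_append_of_le X Y d hi hX, M.append_mem_accepts_iff, hstart] at hacc
      exact .inr ⟨i, hi, hX, hacc⟩
    · obtain ⟨k, rfl⟩ := Nat.exists_eq_add_of_le hX.le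
      have hk : 1 ≤ k := by omega
      rw [List.take_drop_append_length_add X Y d hk] at hacc
      exact .inl ⟨h1, h2, k, hk, by omega, hacc⟩
  · have hlen : X.length + d ≤ (X ++ Y).length := by rw [List.length_append]; omega
    rintro (⟨-, -, i, hi, hid, hacc⟩ | ⟨i, hi, hX, hacc⟩)
    · refine ⟨by omega, hlen, X.length + i, by omega, by omega, ?_⟩
      rwa [List.take_drop_append_length_add X Y d hi]
    · refine ⟨by omega, hlen, i, hi, by omega, ?_⟩
      rwa [List.take_drop_append_of_le X Y d hi hX, M.append_mem_accepts_iff, hstart]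
end
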